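/- Scaling invariance of the derivative-based scaled closure: fix M ≥ 3, let N be any map sending an (M+2)-tuple of functions ℝ → ℝ to a function ℝ → ℝ, and let G be the associated derivative-based scaled closure. Suppose ρ(x) > 0 and θ(x) > 0 for all x. Then for all λ > 0 and μ > 0: (i) G[λρ, u, θ, λf_3, …, λf_M, Kn] = λ · G[ρ, u, θ, f_3, …, f_M, Kn], and (ii) G[ρ, μu, μ²θ, μ³f_3, …, μ^M f_M, Kn/μ] = μ^{M+1} · G[ρ, u, θ, f_3, …, f_M, Kn], where scalar multiples of functions are taken pointwise. -/

import Mathlib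

/-- The derivative-based scaled closure associated with a map `N` from `(M+2)`-tuples of
functions to functions:
`G[ρ, u, θ, f_3, …, f_M, Kn](x) = ρ(x) θ(x)^{(M+1)/2} ·
  N(ρ'/ρ, u'/√θ, θ'/θ, f_3/(ρθ^{3/2}), …, f_M/(ρθ^{M/2}), √θ·Kn)(x)`.
The tuple argument of `N` is indexed by `Fin (M + 2)`: index `0, 1, 2` carry the scaled
derivatives of `ρ, u, θ`, indices `3 ≤ j ≤ M` carry the scaled moment coefficients
`f_j/(ρθ^{j/2})`, and index `M + 1` carries `√θ·Kn`. -/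
noncomputable def scaledClosure (M : ℕ) (N : (Fin (M + 2) → ℝ → ℝ) → ℝ → ℝ)
    (ρ u θ : ℝ → ℝ) (fm : ℕ → ℝ → ℝ) (Kn : ℝ) : ℝ → ℝ :=
  fun x =>
    ρ x * Real.sqrt (θ x) ^ (M + 1) *
      N (fun j y =>
          if (j : ℕ) = 0 then deriv ρ y / ρ y
          else if (j : ℕ) = 1 then deriv u y / Real.sqrt (θ y)
          else if (j : ℕ) = 2 then deriv θ y / θ y
          else if (j : ℕ) = M + 1 then Real.sqrt (θ y) * Kn
          else fm (j : ℕ) y / (ρ y * Real.sqrt (θ y) ^ (j : ℕ))) x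

/-- Scaling invariance of the derivative-based scaled closure: for `λ, μ > 0`,
`G[λρ, u, θ, λf₃, …, λf_M, Kn] = λ G[ρ, u, θ, f₃, …, f_M, Kn]` and
`G[ρ, μu, μ²θ, μ³f₃, …, μ^M f_M, Kn/μ] = μ^{M+1} G[ρ, u, θ, f₃, …, f_M, Kn]`. -/
theorem scaled_closure_scaling (M : ℕ) (hM : 3 ≤ M)
    (N : (Fin (M + 2) → ℝ → ℝ) → ℝ → ℝ)
    (ρ u θ : ℝ → ℝ) (fm : ℕ → ℝ → ℝ) (Kn : ℝ)
    (hρ : ∀ x, 0 < ρ x) (hθ : ∀ x, 0 < θ x)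
    (lam mu : ℝ) (hlam : 0 < lam) (hmu : 0 < mu) :
    (scaledClosure M N (fun x => lam * ρ x) u θ (fun j x => lam * fm j x) Kn
        = fun x => lam * scaledClosure M N ρ u θ fm Kn x) ∧
    (scaledClosure M N ρ (fun x => mu * u x) (fun x => mu ^ 2 * θ x)
        (fun j x => mu ^ j * fm j x) (Kn / mu)
        = fun x => mu ^ (M + 1) * scaledClosure M N ρ u θ fm Kn x) := by
  have hsqrt (y : ℝ) : Real.sqrt (mu ^ 2 * θ y) = mu * Real.sqrt (θ y) := by
    rw [Real.sqrt_mul (sq_nonneg mu), Real.sqrt_sq hmu.le]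
  constructor
  · funext x
    simp only [scaledClosure, deriv_const_mul_field, mul_assoc,
      mul_div_mul_left _ _ hlam.ne']
  · funext x
    simp only [scaledClosure, hsqrt, deriv_const_mul_field, mul_pow,
      mul_div_mul_left _ _ hmu.ne', mul_div_mul_left _ _ (pow_pos hmu 2).ne',
      mul_left_comm (ρ _) (mu ^ _), mul_div_mul_left _ _ (pow_pos hmu _).ne',
      mul_right_comm mu, mul_assoc]
    congr 4
    funext j y
    split_ifs <;> field_simp
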